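/- arXiv:2003.00510 — 2 statements merged into one kernel-verified Lean document; each statement's English description precedes it below -/
import Mathlib

section
/- There exists an absolute constant C > 0 with the following property. Let p be a prime and A ⊆ F_p² with p ≤ |A| ≤ p^{4/3}. Set k := √(8|A|) and K := |A|^{4/3}·p^{−2/3}; let Γ be the set of all lines and circles containing at least k points of A. For c ∈ F_p² let A_c be the set of points of A lying on some circle in Γ centred at c, and for a direction v (a nonzero vector of F_p² up to scaling) let A_v be the set of points of A lying on some line in Γ with direction v. Let C₁ := {c : |A_c| > K}, V₁ := {v : |A_v| > K}, and let L₁ be the set of lines ℓ with b*_A(ℓ) > 0 that pass through some point of C₁ or whose direction w satisfies w·v = 0 for some v ∈ V₁. Then Σ_{ℓ ∈ L₁} ( i_A(ℓ) − |A|/p )·b*_A(ℓ) ≤ C·|A|³/K = C·p^{2/3}·|A|^{5/3}. -/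
namespace Stmt15

/-- The (algebraic) squared distance in the plane `F²`. -/
def dist2 {F : Type*} [CommRing F] (x y : F × F) : F :=
  (x.1 - y.1) ^ 2 + (x.2 - y.2) ^ 2

/-- The dot product on `F²`. -/
def dot {F : Type*} [CommRing F] (x y : F × F) : F :=
  x.1 * y.1 + x.2 * y.2

/-- A line in `F²`. -/
def IsLine {F : Type*} [CommRing F] (L : Set (F × F)) : Prop :=
  ∃ x v : F × F, v ≠ 0 ∧ L = {y | ∃ t : F, y = x + t • v}

/-- `L` is a line with direction `v`. -/
def HasDir {F : Type*} [CommRing F] (L : Set (F × F)) (v : F × F) : Prop :=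
  ∃ x : F × F, L = {y | ∃ t : F, y = x + t • v}

/-- A circle in `F²`: centre `c`, radius `r ≠ 0`. -/
def IsCircle {F : Type*} [CommRing F] (S : Set (F × F)) : Prop :=
  ∃ (c : F × F) (r : F), r ≠ 0 ∧ S = {x | dist2 x c = r}

/-- `γ` is a circle centred at `c` (of non-zero radius). -/
def IsCircleCentred {F : Type*} [CommRing F] (γ : Set (F × F)) (c : F × F) : Prop :=
  ∃ r : F, r ≠ 0 ∧ γ = {x | dist2 x c = r}

/-- The perpendicular bisector `B(a,b) = {x | d(a,x) = d(b,x)}`. -/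
def bisector {F : Type*} [CommRing F] (a b : F × F) : Set (F × F) :=
  {x | dist2 a x = dist2 b x}

/-- `b*_A(ℓ)`: pairs `(b,c) ∈ A²`, `b ≠ c`, `(b-c)·(b-c) ≠ 0`, with bisector `ℓ`. -/
noncomputable def bstarL {F : Type*} [CommRing F] (A : Finset (F × F)) (ℓ : Set (F × F)) : ℕ :=
  Set.ncard {q : (F × F) × (F × F) |
    q.1 ∈ A ∧ q.2 ∈ A ∧ q.1 ≠ q.2 ∧
    dot (q.1 - q.2) (q.1 - q.2) ≠ 0 ∧ bisector q.1 q.2 = ℓ}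

/-- `i_A(ℓ) = |A ∩ ℓ|`. -/
noncomputable def iA {F : Type*} [CommRing F] (A : Finset (F × F)) (ℓ : Set (F × F)) : ℕ :=
  ((A : Set (F × F)) ∩ ℓ).ncard

/-! ### Rich families with small pairwise intersections -/

/-- Subsets of `A` with at least `√(8|A|)` elements and pairwise intersections of size at most `2`
have total size at most `2|A|`. -/
lemma sum_card_le_of_inter_card_le_two {ι X : Type*} [DecidableEq ι] [DecidableEq X]
    (A : Finset X) (S : Finset ι) (P : ι → Finset X) (hsub : ∀ i ∈ S, P i ⊆ A)
    (hpair : ∀ i ∈ S, ∀ j ∈ S, i ≠ j → (P i ∩ P j).card ≤ 2)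
    (hrich : ∀ i ∈ S, 8 * A.card ≤ (P i).card ^ 2) :
    ∑ i ∈ S, (P i).card ≤ 2 * A.card := by
  set m : X → ℕ := fun a => (S.filter fun i => a ∈ P i).card with hm
  set I := ∑ i ∈ S, (P i).card with hI
  have hfilter : ∀ Q ⊆ A, Q.card = ∑ a ∈ A, if a ∈ Q then 1 else 0 := by
    intro Q hQ
    rw [← Finset.card_filter, Finset.filter_mem_eq_inter, Finset.inter_eq_right.mpr hQ]
  have hIm : I = ∑ a ∈ A, m a := by
    rw [hI, Finset.sum_congr rfl fun i hi => hfilter (P i) (hsub i hi), Finset.sum_comm]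
    exact Finset.sum_congr rfl fun a _ => (Finset.card_filter _ _).symm
  have hsq : ∑ a ∈ A, m a ^ 2 = ∑ i ∈ S, ∑ j ∈ S, (P i ∩ P j).card := by
    have h : ∀ i ∈ S, ∀ j ∈ S, (P i ∩ P j).card
        = ∑ a ∈ A, (if a ∈ P i then 1 else 0) * (if a ∈ P j then 1 else 0) := by
      intro i hi j _
      rw [hfilter _ (Finset.inter_subset_left.trans (hsub i hi))]
      refine Finset.sum_congr rfl fun a _ => ?_
      simp only [Finset.mem_inter]
      by_cases hi : a ∈ P i <;> by_cases hj : a ∈ P j <;> simp [hi, hj]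
    rw [Finset.sum_congr rfl fun i hi => Finset.sum_congr rfl fun j hj => h i hi j hj,
      Finset.sum_congr rfl fun i _ => Finset.sum_comm, Finset.sum_comm]
    refine Finset.sum_congr rfl fun a _ => ?_
    rw [sq, hm]
    simp only [Finset.card_filter]
    rw [Finset.sum_mul_sum]
  have hle : ∑ i ∈ S, ∑ j ∈ S, (P i ∩ P j).card ≤ I + 2 * S.card ^ 2 := by
    have h : ∀ i ∈ S, ∑ j ∈ S, (P i ∩ P j).card ≤ (P i).card + 2 * S.card := by
      intro i hi
      rw [← Finset.add_sum_erase S _ hi, Finset.inter_self]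
      gcongr
      calc ∑ j ∈ S.erase i, (P i ∩ P j).card ≤ ∑ j ∈ S.erase i, 2 :=
            Finset.sum_le_sum fun j hj =>
              hpair i hi j (Finset.mem_of_mem_erase hj) (Finset.ne_of_mem_erase hj).symm
        _ ≤ 2 * S.card := by
            rw [Finset.sum_const, smul_eq_mul, mul_comm]
            gcongr
            exact Finset.erase_subset _ _
    calc _ ≤ ∑ i ∈ S, ((P i).card + 2 * S.card) := Finset.sum_le_sum h
      _ = I + 2 * S.card ^ 2 := by
          rw [Finset.sum_add_distrib, Finset.sum_const, smul_eq_mul]; ring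
  have hcs : I ^ 2 ≤ A.card * (I + 2 * S.card ^ 2) := by
    calc I ^ 2 ≤ A.card * ∑ a ∈ A, m a ^ 2 := by rw [hIm]; exact sq_sum_le_card_mul_sum_sq
      _ ≤ _ := by rw [hsq]; gcongr
  have hlow : 8 * A.card * S.card ^ 2 ≤ I ^ 2 := by
    rw [← Nat.cast_le (α := ℝ)]
    push_cast
    have h : (S.card : ℝ) * √(8 * A.card) ≤ I := by
      rw [hI, Nat.cast_sum, ← nsmul_eq_mul]
      refine Finset.card_nsmul_le_sum _ _ _ fun i hi => Real.sqrt_le_iff.mpr ⟨by positivity, ?_⟩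
      exact_mod_cast hrich i hi
    calc 8 * (A.card : ℝ) * S.card ^ 2 = (S.card * √(8 * A.card)) ^ 2 := by
          rw [mul_pow, Real.sq_sqrt (by positivity)]; ring
      _ ≤ (I : ℝ) ^ 2 := by gcongr
  by_contra! h
  nlinarith

/-- If each `i ∈ S` carries rich sets `P i j` of total size at least `K`, then `|S| K ≤ 2|A|`. -/
lemma card_mul_le_of_rich {ι κ X : Type*} [DecidableEq ι] [DecidableEq κ] [DecidableEq X]
    (A : Finset X) (S : Finset ι) (R : ι → Finset κ) (P : ι → κ → Finset X)
    (hsub : ∀ i ∈ S, ∀ j ∈ R i, P i j ⊆ A)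
    (hpair : ∀ i ∈ S, ∀ j ∈ R i, ∀ i' ∈ S, ∀ j' ∈ R i', (i = i' → j ≠ j') →
      (P i j ∩ P i' j').card ≤ 2)
    (hrich : ∀ i ∈ S, ∀ j ∈ R i, 8 * A.card ≤ (P i j).card ^ 2)
    (K : ℝ) (hK : ∀ i ∈ S, K ≤ ((∑ j ∈ R i, (P i j).card : ℕ) : ℝ)) :
    S.card * K ≤ 2 * A.card := by
  have h := sum_card_le_of_inter_card_le_two A (S.sigma R) (fun x => P x.1 x.2)
    (fun x hx => hsub _ (Finset.mem_sigma.mp hx).1 _ (Finset.mem_sigma.mp hx).2)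
    (fun x hx y hy hxy => hpair _ (Finset.mem_sigma.mp hx).1 _ (Finset.mem_sigma.mp hx).2
      _ (Finset.mem_sigma.mp hy).1 _ (Finset.mem_sigma.mp hy).2
      (fun h1 h2 => hxy (Sigma.ext h1 (heq_of_eq h2))))
    (fun x hx => hrich _ (Finset.mem_sigma.mp hx).1 _ (Finset.mem_sigma.mp hx).2)
  rw [Finset.sum_sigma] at h
  calc (S.card : ℝ) * K ≤ ∑ i ∈ S, ((∑ j ∈ R i, (P i j).card : ℕ) : ℝ) := by
        rw [← nsmul_eq_mul]; exact Finset.card_nsmul_le_sum _ _ _ hK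
    _ ≤ 2 * A.card := by exact_mod_cast h

/-! ### Plane geometry -/

section Geometry

variable {F : Type*} [Field F]

/-- The `2 × 2` determinant of two vectors of `F²`. -/
def det2 (u v : F × F) : F := u.1 * v.2 - u.2 * v.1

/-- The representative of the direction of a nonzero vector whose first nonzero coordinate
is `1`. -/
def IsNormalized (u : F × F) : Prop := u.1 = 1 ∨ u.1 = 0 ∧ u.2 = 1

lemma IsNormalized.ne_zero {u : F × F} (hu : IsNormalized u) : u ≠ 0 := by
  rintro rfl
  simp [IsNormalized] at hu

lemma exists_isNormalized_smul {v : F × F} (hv : v ≠ 0) :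
    ∃ u, IsNormalized u ∧ ∃ t : F, t ≠ 0 ∧ v = t • u := by
  by_cases h : v.1 = 0
  · have h2 : v.2 ≠ 0 := fun h2 => hv (Prod.ext h h2)
    exact ⟨(0, 1), Or.inr ⟨rfl, rfl⟩, v.2, h2, Prod.ext (by simp [h]) (by simp)⟩
  · refine ⟨(1, v.2 / v.1), Or.inl rfl, v.1, h, Prod.ext (by simp) ?_⟩
    simp only [Prod.smul_snd, smul_eq_mul]
    field_simp

lemma exists_smul_of_det2_eq_zero {u v : F × F} (hv : v ≠ 0) (h : det2 v u = 0) :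
    ∃ t : F, u = t • v := by
  unfold det2 at h
  by_cases h1 : v.1 = 0
  · have h2 : v.2 ≠ 0 := fun h2 => hv (Prod.ext h1 h2)
    refine ⟨u.2 / v.2, Prod.ext ?_ ?_⟩ <;> simp only [Prod.smul_fst, Prod.smul_snd, smul_eq_mul]
    · rw [h1, zero_mul, zero_sub, neg_eq_zero] at h
      rw [h1, mul_zero]
      exact (mul_eq_zero.mp h).resolve_left h2
    · field_simp
  · refine ⟨u.1 / v.1, Prod.ext ?_ ?_⟩ <;> simp only [Prod.smul_fst, Prod.smul_snd, smul_eq_mul]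
    · field_simp
    · field_simp
      linear_combination h

lemma IsNormalized.eq_of_det2_eq_zero {u v : F × F} (hu : IsNormalized u) (hv : IsNormalized v)
    (h : det2 u v = 0) : u = v := by
  obtain ⟨u1, u2⟩ := u
  obtain ⟨v1, v2⟩ := v
  simp only [IsNormalized, det2, Prod.mk.injEq] at *
  rcases hu with rfl | ⟨rfl, rfl⟩ <;> rcases hv with rfl | ⟨rfl, rfl⟩ <;> simp at h ⊢
  exact (sub_eq_zero.mp h).symm

/-- The vector `u` rotated by a right angle. -/
def perp (u : F × F) : F × F := (-u.2, u.1)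

lemma perp_ne_zero {u : F × F} (hu : u ≠ 0) : perp u ≠ 0 := fun h =>
  hu (Prod.ext (congrArg Prod.snd h) (neg_eq_zero.mp (congrArg Prod.fst h)))

lemma setOf_add_smul_eq {u : F × F} (hu : u ≠ 0) (x : F × F) :
    {y | ∃ t : F, y = x + t • u} = {y | det2 u y = det2 u x} := by
  ext y
  constructor
  · rintro ⟨t, rfl⟩
    simp only [det2, Set.mem_ofPred_eq, Prod.fst_add, Prod.snd_add, Prod.smul_fst, Prod.smul_snd,
      smul_eq_mul]
    ring
  · intro h
    obtain ⟨t, ht⟩ := exists_smul_of_det2_eq_zero (u := y - x) hu (by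
      simp only [det2, Set.mem_ofPred_eq, Prod.fst_sub, Prod.snd_sub] at h ⊢
      linear_combination h)
    exact ⟨t, by rw [← ht]; abel⟩

lemma HasDir.exists_eq_setOf_det2 {γ : Set (F × F)} {u v : F × F} {t : F} (hu : u ≠ 0)
    (ht : t ≠ 0) (hv : v = t • u) (h : HasDir γ v) : ∃ s, γ = {y | det2 u y = s} := by
  obtain ⟨x, rfl⟩ := h
  refine ⟨det2 u x, ?_⟩
  rw [setOf_add_smul_eq (by rw [hv]; exact smul_ne_zero ht hu)]
  ext y
  have h : ∀ z, det2 v z = t * det2 u z := fun z => by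
    rw [hv]; simp only [det2, Prod.smul_fst, Prod.smul_snd, smul_eq_mul]; ring
  simp only [Set.mem_ofPred_eq, h, mul_right_inj' ht]

/-- A point determines the reflections of `b` in the lines through it with given non-isotropic
normal `n`. -/
lemma eq_of_mem_bisector_of_smul {a b b' b'' n : F × F} {s t : F}
    (hs : b' - b = s • n) (ht : b'' - b = t • n) (h' : b ≠ b') (h'' : b ≠ b'')
    (hn : dot (b - b') (b - b') ≠ 0) (ha' : a ∈ bisector b b') (ha'' : a ∈ bisector b b'') :
    b' = b'' := by
  have e' : b' = b + s • n := by rw [← hs]; abel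
  have e'' : b'' = b + t • n := by rw [← ht]; abel
  subst e' e''
  have hs0 : s ≠ 0 := by rintro rfl; simp at h'
  have ht0 : t ≠ 0 := by rintro rfl; simp at h''
  simp only [bisector, dist2, dot, Set.mem_ofPred_eq, Prod.fst_add, Prod.snd_add, Prod.smul_fst,
    Prod.smul_snd, smul_eq_mul, Prod.fst_sub, Prod.snd_sub] at *
  have hnn : n.1 ^ 2 + n.2 ^ 2 ≠ 0 := fun h => hn (by linear_combination s ^ 2 * h)
  have k1 : 2 * ((b.1 - a.1) * n.1 + (b.2 - a.2) * n.2) + s * (n.1 ^ 2 + n.2 ^ 2) = 0 :=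
    mul_left_cancel₀ hs0 (by linear_combination -ha')
  have k2 : 2 * ((b.1 - a.1) * n.1 + (b.2 - a.2) * n.2) + t * (n.1 ^ 2 + n.2 ^ 2) = 0 :=
    mul_left_cancel₀ ht0 (by linear_combination -ha'')
  have : s = t := mul_right_cancel₀ hnn (by linear_combination k1 - k2)
  rw [this]

lemma two_mul_dot_sub_eq_zero {b b' a c : F × F} (ha : a ∈ bisector b b')
    (hc : c ∈ bisector b b') : 2 * dot (a - c) (b' - b) = 0 := by
  simp only [bisector, dist2, dot, Set.mem_ofPred_eq, Prod.fst_sub, Prod.snd_sub] at *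
  linear_combination ha - hc

lemma exists_smul_perp_of_dot_eq_zero {d u : F × F} (hd : d ≠ 0) (h : dot d u = 0) :
    ∃ t : F, u = t • perp d := by
  refine exists_smul_of_det2_eq_zero (perp_ne_zero hd) ?_
  simp only [det2, perp, dot] at *
  linear_combination -h

lemma exists_smul_perp_of_mem_bisector (h2 : (2 : F) ≠ 0) {b b' a c : F × F} (hac : a ≠ c)
    (ha : a ∈ bisector b b') (hc : c ∈ bisector b b') : ∃ t : F, b' - b = t • perp (a - c) :=
  exists_smul_perp_of_dot_eq_zero (sub_ne_zero.mpr hac)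
    ((mul_eq_zero.mp (two_mul_dot_sub_eq_zero ha hc)).resolve_left h2)

/-- If a nonempty bisector of `b, b'` has a direction orthogonal to `v ≠ 0`, then `b' - b` is
parallel to `v`. -/
lemma exists_smul_of_hasDir_bisector {a b b' v w : F × F} (hv : v ≠ 0)
    (ha : a ∈ bisector b b') (hw : HasDir (bisector b b') w) (hwv : dot w v = 0) :
    ∃ t : F, b' - b = t • v := by
  have ha' : a + perp (b' - b) ∈ bisector b b' := by
    simp only [bisector, dist2, perp, Set.mem_ofPred_eq, Prod.fst_add, Prod.snd_add, Prod.fst_sub,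
      Prod.snd_sub] at *
    linear_combination ha
  obtain ⟨x, hx⟩ := hw
  rw [hx] at ha ha'
  obtain ⟨s, hs⟩ := ha
  obtain ⟨t, ht⟩ := ha'
  have hp : perp (b' - b) = (t - s) • w := by
    rw [hs] at ht
    rw [sub_smul]
    linear_combination ht
  refine exists_smul_of_det2_eq_zero hv ?_
  have h1 := congrArg Prod.fst hp
  have h2 := congrArg Prod.snd hp
  simp only [perp, det2, dot, Prod.smul_fst, Prod.smul_snd, smul_eq_mul] at *
  linear_combination (-v.1) * h1 - v.2 * h2 - (t - s) * hwv

/-- Distinct circles of nonzero radius do not share three points. -/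
lemma no_three_common_points (h2 : (2 : F) ≠ 0) {c c' : F × F} {r r' : F} (hr : r ≠ 0)
    (hne : c = c' → r ≠ r') {x y z : F × F} (hxy : x ≠ y) (hxz : x ≠ z) (hyz : y ≠ z)
    (hx : dist2 x c = r) (hy : dist2 y c = r) (hz : dist2 z c = r)
    (hx' : dist2 x c' = r') (hy' : dist2 y c' = r') (hz' : dist2 z c' = r') : False := by
  have hc : c ≠ c' := fun h => hne h (by rw [← hx, ← hx', h])
  have hmem : ∀ y, dist2 y c = r → dist2 y c' = r' → ∃ t : F, y - x = t • perp (c - c') := by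
    intro y hy hy'
    exact exists_smul_perp_of_mem_bisector h2 hc
      (show dist2 x c = dist2 y c by rw [hx, hy]) (show dist2 x c' = dist2 y c' by rw [hx', hy'])
  obtain ⟨s, hs⟩ := hmem y hy hy'
  obtain ⟨t, ht⟩ := hmem z hz hz'
  have hn : perp (c - c') ≠ 0 := perp_ne_zero (sub_ne_zero.mpr hc)
  generalize perp (c - c') = n at hs ht hn
  have ey : y = x + s • n := by rw [← hs]; abel
  have ez : z = x + t • n := by rw [← ht]; abel
  by_cases hnn : dot (x - y) (x - y) = 0
  · have hs0 : s ≠ 0 := by rintro rfl; simp [ey] at hxy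
    subst ey
    simp only [dist2, dot, Prod.fst_add, Prod.snd_add, Prod.smul_fst, Prod.smul_snd,
      smul_eq_mul, Prod.fst_sub, Prod.snd_sub] at *
    have k0 : n.1 ^ 2 + n.2 ^ 2 = 0 :=
      mul_left_cancel₀ (pow_ne_zero 2 hs0) (by linear_combination hnn)
    have k1 : (x.1 - c.1) * n.1 + (x.2 - c.2) * n.2 = 0 :=
      mul_left_cancel₀ (mul_ne_zero h2 hs0) (by linear_combination hy - hx - s ^ 2 * k0)
    have n1 : n.1 ≠ 0 := by
      intro h
      rw [h] at k0
      exact hn (Prod.ext h (pow_eq_zero_iff two_ne_zero |>.mp (by linear_combination k0)))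
    refine hr (mul_left_cancel₀ (pow_ne_zero 2 n1) ?_)
    rw [← hx]
    linear_combination ((x.1 - c.1) * n.1 - (x.2 - c.2) * n.2) * k1 + (x.2 - c.2) ^ 2 * k0
  · exact hyz (eq_of_mem_bisector_of_smul (a := c) hs ht hxy hxz hnn
      (show dist2 x c = dist2 y c by rw [hx, hy]) (show dist2 x c = dist2 z c by rw [hx, hz]))

/-- Distinct lines in normalized form share at most one point. -/
lemma eq_of_mem_two_lines {u u' : F × F} {s s' : F} (hu : IsNormalized u) (hu' : IsNormalized u')
    (hne : u = u' → s ≠ s') {x y : F × F} (hx : det2 u x = s) (hy : det2 u y = s)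
    (hx' : det2 u' x = s') (hy' : det2 u' y = s') : x = y := by
  by_contra hxy
  have key : ∀ u : F × F, IsNormalized u → det2 u x = det2 u y → ∃ t : F, x - y = t • u := by
    intro u hu h
    refine exists_smul_of_det2_eq_zero hu.ne_zero ?_
    simp only [det2, Prod.fst_sub, Prod.snd_sub] at *
    linear_combination h
  obtain ⟨t, ht⟩ := key u hu (hx.trans hy.symm)
  obtain ⟨t', ht'⟩ := key u' hu' (hx'.trans hy'.symm)
  have ht0 : t ≠ 0 := by rintro rfl; exact hxy (sub_eq_zero.mp (by simpa using ht))
  have huu : u = u' := by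
    refine hu.eq_of_det2_eq_zero hu' (mul_left_cancel₀ ht0 ?_)
    have h := ht.symm.trans ht'
    have h1 := congrArg Prod.fst h
    have h2 := congrArg Prod.snd h
    simp only [det2, Prod.smul_fst, Prod.smul_snd, smul_eq_mul] at *
    linear_combination u'.2 * h1 - u'.1 * h2
  exact hne huu (by rw [← hx, ← hx', huu])

end Geometry

/-! ### Counting -/

section Counting

variable {F : Type*} [Field F]

/-- `(a, b, b')` is a triangle with `d(a, b) = d(a, b')` and non-isotropic base `b, b'`. -/
def IsIsosceles (t : (F × F) × (F × F) × (F × F)) : Prop :=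
  t.2.1 ≠ t.2.2 ∧ dot (t.2.1 - t.2.2) (t.2.1 - t.2.2) ≠ 0 ∧ t.1 ∈ bisector t.2.1 t.2.2

lemma IsIsosceles.two_ne_zero {t : (F × F) × (F × F) × (F × F)} (ht : IsIsosceles t) :
    (2 : F) ≠ 0 := by
  obtain ⟨a, b, b'⟩ := t
  intro h2
  obtain ⟨-, hn, ha⟩ := ht
  simp only [bisector, dist2, dot, Set.mem_ofPred_eq, Prod.fst_sub, Prod.snd_sub] at *
  refine hn ?_
  linear_combination ha + ((b'.1 - a.1) ^ 2 + (b'.2 - a.2) ^ 2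
    - ((b.1 - a.1) * (b'.1 - a.1) + (b.2 - a.2) * (b'.2 - a.2))) * h2

open Classical in
lemma card_isosceles_through_le (A : Finset (F × F)) (c : F × F) :
    ((A ×ˢ A ×ˢ A).filter fun t => IsIsosceles t ∧ c ∈ bisector t.2.1 t.2.2).card
      ≤ 2 * A.card ^ 2 := by
  rw [← Finset.card_filter_add_card_filter_not (fun t => t.1 = c), two_mul, sq,
    ← Finset.card_product]
  refine add_le_add (Finset.card_le_card_of_injOn (fun t => t.2) ?_ ?_)
    (Finset.card_le_card_of_injOn (fun t => (t.1, t.2.1)) ?_ ?_)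
  · rintro t ht
    simp only [Finset.coe_filter, Finset.mem_filter, Finset.mem_product,
      Set.mem_ofPred_eq] at ht
    exact Finset.mem_coe.mpr (Finset.mem_product.mpr ht.1.1.2)
  · rintro t ht t' ht' h
    simp only [Finset.coe_filter, Finset.mem_filter, Set.mem_ofPred_eq] at ht ht'
    exact Prod.ext (ht.2.trans ht'.2.symm) h
  · rintro t ht
    simp only [Finset.coe_filter, Finset.mem_filter, Finset.mem_product,
      Set.mem_ofPred_eq] at ht
    exact Finset.mem_coe.mpr (Finset.mem_product.mpr ⟨ht.1.1.1, ht.1.1.2.1⟩)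
  · rintro ⟨a, b, b'⟩ ht ⟨a', x, b''⟩ ht' h
    obtain ⟨rfl, rfl⟩ := Prod.mk.inj h
    simp only [Finset.coe_filter, Finset.mem_filter, Set.mem_ofPred_eq] at ht ht'
    obtain ⟨⟨-, hI, hc⟩, hac⟩ := ht
    obtain ⟨⟨-, hI', hc'⟩, -⟩ := ht'
    obtain ⟨s, hs⟩ := exists_smul_perp_of_mem_bisector hI.two_ne_zero hac hI.2.2 hc
    obtain ⟨s', hs'⟩ := exists_smul_perp_of_mem_bisector hI.two_ne_zero hac hI'.2.2 hc'
    have e : b' = b'' :=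
      eq_of_mem_bisector_of_smul hs hs' hI.1 hI'.1 hI.2.1 hI.2.2 hI'.2.2
    rw [e]

open Classical in
lemma card_isosceles_parallel_le (A : Finset (F × F)) (v : F × F) :
    ((A ×ˢ A ×ˢ A).filter fun t => IsIsosceles t ∧ ∃ s : F, t.2.2 - t.2.1 = s • v).card
      ≤ A.card ^ 2 := by
  rw [sq, ← Finset.card_product]
  refine Finset.card_le_card_of_injOn (fun t => (t.1, t.2.1)) ?_ ?_
  · rintro t ht
    simp only [Finset.coe_filter, Finset.mem_product, Set.mem_ofPred_eq] at ht
    exact Finset.mem_coe.mpr (Finset.mem_product.mpr ⟨ht.1.1, ht.1.2.1⟩)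
  · rintro ⟨a, b, b'⟩ ht ⟨a', x, b''⟩ ht' h
    obtain ⟨rfl, rfl⟩ := Prod.mk.inj h
    simp only [Finset.coe_filter, Set.mem_ofPred_eq] at ht ht'
    obtain ⟨-, hI, s, hs⟩ := ht
    obtain ⟨-, hI', s', hs'⟩ := ht'
    have e : b' = b'' :=
      eq_of_mem_bisector_of_smul hs hs' hI.1 hI'.1 hI.2.1 hI.2.2 hI'.2.2
    rw [e]

open Classical in
lemma iA_mul_bstarL (A : Finset (F × F)) (ℓ : Set (F × F)) :
    iA A ℓ * bstarL A ℓ = ((A ×ˢ A ×ˢ A).filter fun t =>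
      IsIsosceles t ∧ bisector t.2.1 t.2.2 = ℓ).card := by
  have h1 : iA A ℓ = (A.filter (· ∈ ℓ)).card := by
    rw [iA, ← Set.ncard_coe_finset, Finset.coe_filter]
    rfl
  have h2 : bstarL A ℓ = ((A ×ˢ A).filter fun q => q.1 ≠ q.2 ∧
      dot (q.1 - q.2) (q.1 - q.2) ≠ 0 ∧ bisector q.1 q.2 = ℓ).card := by
    rw [bstarL, ← Set.ncard_coe_finset, Finset.coe_filter]
    simp only [Finset.mem_product, and_assoc]
  rw [h1, h2, ← Finset.card_product]
  congr 1
  ext ⟨a, b, b'⟩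
  simp only [Finset.mem_product, Finset.mem_filter]
  constructor
  · rintro ⟨⟨ha, hl⟩, hb, hne, hn, rfl⟩
    exact ⟨⟨ha, hb⟩, ⟨hne, hn, hl⟩, rfl⟩
  · rintro ⟨⟨ha, hb⟩, ⟨hne, hn, hl⟩, rfl⟩
    exact ⟨⟨ha, hl⟩, hb, hne, hn, rfl⟩

open Classical in
lemma finsum_sub_mul_bstarL_le [Finite F] (A : Finset (F × F)) (L : Set (Set (F × F))) {x : ℝ}
    (hx : 0 ≤ x) :
    ∑ᶠ ℓ ∈ L, ((iA A ℓ : ℝ) - x) * (bstarL A ℓ : ℝ) ≤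
      (((A ×ˢ A ×ˢ A).filter fun t => IsIsosceles t ∧ bisector t.2.1 t.2.2 ∈ L).card : ℝ) := by
  have hL := Set.toFinite L
  rw [finsum_mem_eq_finite_toFinset_sum _ hL,
    Finset.card_eq_sum_card_fiberwise (f := fun t => bisector t.2.1 t.2.2) (t := hL.toFinset)
      (fun t ht => by
        simp only [Finset.coe_filter, Set.mem_ofPred_eq] at ht
        simpa using ht.2.2), Nat.cast_sum]
  refine Finset.sum_le_sum fun ℓ hℓ => ?_
  have hℓL : ℓ ∈ L := hL.mem_toFinset.mp hℓ
  have : ((A ×ˢ A ×ˢ A).filter fun t => IsIsosceles t ∧ bisector t.2.1 t.2.2 ∈ L).filter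
      (fun t => bisector t.2.1 t.2.2 = ℓ) = (A ×ˢ A ×ˢ A).filter fun t =>
        IsIsosceles t ∧ bisector t.2.1 t.2.2 = ℓ := by
    rw [Finset.filter_filter]
    refine Finset.filter_congr fun t _ => ?_
    constructor
    · rintro ⟨⟨h, -⟩, h'⟩
      exact ⟨h, h'⟩
    · rintro ⟨h, rfl⟩
      exact ⟨⟨h, hℓL⟩, rfl⟩
  rw [this, ← iA_mul_bstarL, Nat.cast_mul]
  gcongr
  linarith

open Classical in
/-- If sets `Q s`, each containing at least `√(8|A|)` points of `A`, cover more than `K` points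
of `A`, then these richly covered parts have total size at least `K`. -/
lemma le_sum_card_of_lt_ncard {X κ : Type*} (A : Finset X) (Q : κ → Set X) (R : Finset κ)
    (G : Set (Set X))
    (hG : ∀ γ ∈ G, √(8 * (A.card : ℝ)) ≤ (((A : Set X) ∩ γ).ncard : ℝ) ∧
      ∃ s, γ = Q s ∧ (8 * A.card ≤ (A.filter (· ∈ Q s)).card ^ 2 → s ∈ R)) {K : ℝ}
    (hK : K < ({a | a ∈ A ∧ ∃ γ ∈ G, a ∈ γ}.ncard : ℝ)) :
    K ≤ ((∑ s ∈ R, (A.filter (· ∈ Q s)).card : ℕ) : ℝ) := by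
  refine hK.le.trans (Nat.cast_le.mpr (le_trans ?_ Finset.card_biUnion_le))
  rw [← Set.ncard_coe_finset]
  refine Set.ncard_le_ncard ?_ (Finset.finite_toSet _)
  rintro a ⟨ha, γ, hγ, haγ⟩
  obtain ⟨hk, s, rfl, hs⟩ := hG γ hγ
  refine Finset.mem_coe.mpr (Finset.mem_biUnion.mpr
    ⟨s, hs ?_, Finset.mem_filter.mpr ⟨ha, haγ⟩⟩)
  have h : ((A : Set X) ∩ Q s).ncard = (A.filter (· ∈ Q s)).card := by
    rw [← Set.ncard_coe_finset, Finset.coe_filter]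
    rfl
  rw [h] at hk
  exact_mod_cast (Real.sqrt_le_iff.mp hk).2

open Classical in
lemma card_centres_mul_le [Fintype F] (h2 : (2 : F) ≠ 0) (A S : Finset (F × F)) (K : ℝ)
    (hK : ∀ c ∈ S, K < ({a | a ∈ A ∧ ∃ γ ∈ {γ | IsCircleCentred γ c ∧
      √(8 * (A.card : ℝ)) ≤ (((A : Set (F × F)) ∩ γ).ncard : ℝ)}, a ∈ γ}.ncard : ℝ)) :
    S.card * K ≤ 2 * A.card := by
  let P : F × F → F → Finset (F × F) := fun c r => A.filter (· ∈ {x | dist2 x c = r})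
  have hP : ∀ {c r x}, x ∈ P c r → dist2 x c = r := fun hx => (Finset.mem_filter.mp hx).2
  refine card_mul_le_of_rich A S
    (fun c => Finset.univ.filter fun r => r ≠ 0 ∧ 8 * A.card ≤ (P c r).card ^ 2) P
    (fun _ _ _ _ => Finset.filter_subset _ _) ?_
    (fun c _ r hr => (Finset.mem_filter.mp hr).2.2) K fun c hc => ?_
  · intro c _ r hr c' _ r' _ hne
    by_contra! h
    obtain ⟨x, hx, y, hy, z, hz, hxy, hxz, hyz⟩ := Finset.two_lt_card.mp h
    rw [Finset.mem_inter] at hx hy hz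
    exact no_three_common_points h2 (Finset.mem_filter.mp hr).2.1 hne hxy hxz hyz
      (hP hx.1) (hP hy.1) (hP hz.1) (hP hx.2) (hP hy.2) (hP hz.2)
  · refine le_sum_card_of_lt_ncard A (fun r => {x | dist2 x c = r}) _ _ ?_ (hK c hc)
    rintro γ ⟨⟨r, hr, hγ⟩, hk⟩
    exact ⟨hk, r, hγ, fun h => Finset.mem_filter.mpr ⟨Finset.mem_univ _, hr, h⟩⟩

open Classical in
lemma card_directions_mul_le [Fintype F] (A S : Finset (F × F)) (K : ℝ)
    (hS : ∀ u ∈ S, IsNormalized u ∧ ∃ t : F, t ≠ 0 ∧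
      K < ({a | a ∈ A ∧ ∃ γ ∈ {γ | HasDir γ (t • u) ∧
        √(8 * (A.card : ℝ)) ≤ (((A : Set (F × F)) ∩ γ).ncard : ℝ)}, a ∈ γ}.ncard : ℝ)) :
    S.card * K ≤ 2 * A.card := by
  let P : F × F → F → Finset (F × F) := fun u s => A.filter (· ∈ {x | det2 u x = s})
  have hP : ∀ {u s x}, x ∈ P u s → det2 u x = s := fun hx => (Finset.mem_filter.mp hx).2
  refine card_mul_le_of_rich A S
    (fun u => Finset.univ.filter fun s => 8 * A.card ≤ (P u s).card ^ 2) P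
    (fun _ _ _ _ => Finset.filter_subset _ _) ?_
    (fun u _ s hs => (Finset.mem_filter.mp hs).2) K fun u hu => ?_
  · intro u hu s _ u' hu' s' _ hne
    refine (Finset.card_le_one.mpr fun x hx y hy => ?_).trans one_le_two
    rw [Finset.mem_inter] at hx hy
    exact eq_of_mem_two_lines (hS u hu).1 (hS u' hu').1 hne (hP hx.1) (hP hy.1)
      (hP hx.2) (hP hy.2)
  · obtain ⟨hn, t, ht, hK⟩ := hS u hu
    refine le_sum_card_of_lt_ncard A (fun s => {x | det2 u x = s}) _ _ ?_ hK
    rintro γ ⟨hγ, hk⟩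
    obtain ⟨s, hs⟩ := hγ.exists_eq_setOf_det2 hn.ne_zero ht rfl
    exact ⟨hk, s, hs, fun h => Finset.mem_filter.mpr ⟨Finset.mem_univ _, h⟩⟩

open Classical in
/-- Isosceles triangles whose axis passes through `S` or whose base is parallel to an element
of `D`. -/
lemma card_isosceles_le (A S D : Finset (F × F)) (q : (F × F) × (F × F) × (F × F) → Prop)
    (hq : ∀ t, IsIsosceles t → q t → (∃ c ∈ S, c ∈ bisector t.2.1 t.2.2) ∨
      ∃ u ∈ D, ∃ s : F, t.2.2 - t.2.1 = s • u) :
    ((A ×ˢ A ×ˢ A).filter fun t => IsIsosceles t ∧ q t).card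
      ≤ S.card * (2 * A.card ^ 2) + D.card * A.card ^ 2 := by
  calc _ ≤ ((S.biUnion fun c => (A ×ˢ A ×ˢ A).filter fun t =>
          IsIsosceles t ∧ c ∈ bisector t.2.1 t.2.2) ∪
        (D.biUnion fun u => (A ×ˢ A ×ˢ A).filter fun t =>
          IsIsosceles t ∧ ∃ s : F, t.2.2 - t.2.1 = s • u)).card := by
        refine Finset.card_le_card fun t ht => ?_
        obtain ⟨hA, hI, hqt⟩ := Finset.mem_filter.mp ht
        simp only [Finset.mem_union, Finset.mem_biUnion, Finset.mem_filter]
        exact (hq t hI hqt).imp (fun ⟨c, hc, h⟩ => ⟨c, hc, hA, hI, h⟩)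
          (fun ⟨u, hu, h⟩ => ⟨u, hu, hA, hI, h⟩)
    _ ≤ _ := (Finset.card_union_le _ _).trans (add_le_add
        (Finset.card_biUnion_le_card_mul _ _ _ fun c _ => card_isosceles_through_le A c)
        (Finset.card_biUnion_le_card_mul _ _ _ fun u _ => card_isosceles_parallel_le A u))

end Counting

/-- Triangles interacting with rich lines and circles: with `k = √(8|A|)`,
`K = |A|^(4/3)·p^(-2/3)`, `Γ` the `k`-rich lines and circles, `A_c` (resp. `A_v`) the points of
`A` on circles of `Γ` centred at `c` (resp. on lines of `Γ` with direction `v`),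
`C₁ = {c : |A_c| > K}`, `V₁ = {v : |A_v| > K}`, and `L₁` the lines `ℓ` with `b*_A(ℓ) > 0`
passing through a point of `C₁` or orthogonal to a direction of `V₁`, we have
`Σ_{ℓ ∈ L₁} (i_A(ℓ) - |A|/p)·b*_A(ℓ) ≤ C·p^(2/3)·|A|^(5/3)` for an absolute constant `C`. -/
theorem rich_interaction_bound :
    ∃ C : ℝ, 0 < C ∧
      ∀ p : ℕ, p.Prime →
      ∀ A : Finset (ZMod p × ZMod p),
        (p : ℝ) ≤ (A.card : ℝ) → (A.card : ℝ) ≤ (p : ℝ) ^ ((4 : ℝ) / 3) →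
      ∀ k K : ℝ,
        k = Real.sqrt (8 * (A.card : ℝ)) →
        K = (A.card : ℝ) ^ ((4 : ℝ) / 3) * (p : ℝ) ^ (-((2 : ℝ) / 3)) →
      ∀ Γ : Set (Set (ZMod p × ZMod p)),
        Γ = {γ | (IsLine γ ∨ IsCircle γ) ∧
              k ≤ (((A : Set (ZMod p × ZMod p)) ∩ γ).ncard : ℝ)} →
      ∀ Ac : (ZMod p × ZMod p) → Set (ZMod p × ZMod p),
        Ac = (fun c => {a | a ∈ A ∧ ∃ γ ∈ Γ, IsCircleCentred γ c ∧ a ∈ γ}) →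
      ∀ Av : (ZMod p × ZMod p) → Set (ZMod p × ZMod p),
        Av = (fun v => {a | a ∈ A ∧ ∃ γ ∈ Γ, IsLine γ ∧ HasDir γ v ∧ a ∈ γ}) →
      ∀ C₁ : Set (ZMod p × ZMod p), C₁ = {c | K < ((Ac c).ncard : ℝ)} →
      ∀ V₁ : Set (ZMod p × ZMod p), V₁ = {v | v ≠ 0 ∧ K < ((Av v).ncard : ℝ)} →
      ∀ L₁ : Set (Set (ZMod p × ZMod p)),
        L₁ = {ℓ | 0 < bstarL A ℓ ∧
              ((∃ c ∈ C₁, c ∈ ℓ) ∨ (∃ v ∈ V₁, ∃ w, HasDir ℓ w ∧ dot w v = 0))} →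
      (∑ᶠ ℓ ∈ L₁, ((iA A ℓ : ℝ) - (A.card : ℝ) / (p : ℝ)) * (bstarL A ℓ : ℝ)) ≤
        C * (p : ℝ) ^ ((2 : ℝ) / 3) * (A.card : ℝ) ^ ((5 : ℝ) / 3) := by
  classical
  refine ⟨6, by norm_num, ?_⟩
  rintro p hp A hpA - k K rfl hKdef Γ hΓ Ac hAc Av hAv C₁ hC₁ V₁ hV₁ L₁ hL₁
  have := Fact.mk hp
  have hp0 : (0 : ℝ) < p := Nat.cast_pos.mpr hp.pos
  have hA0 : (0 : ℝ) < A.card := hp0.trans_le hpA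
  have hK0 : 0 < K := by rw [hKdef]; positivity
  refine (finsum_sub_mul_bstarL_le A L₁ (by positivity)).trans ?_
  obtain hT | ⟨t₀, ht₀⟩ := ((A ×ˢ A ×ˢ A).filter fun t =>
    IsIsosceles t ∧ bisector t.2.1 t.2.2 ∈ L₁).eq_empty_or_nonempty
  · rw [hT, Finset.card_empty, Nat.cast_zero]
    positivity
  have h2 : (2 : ZMod p) ≠ 0 := (Finset.mem_filter.mp ht₀).2.1.two_ne_zero
  set S : Finset (ZMod p × ZMod p) := Finset.univ.filter (· ∈ C₁)
  set D : Finset (ZMod p × ZMod p) := Finset.univ.filter fun u =>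
    IsNormalized u ∧ ∃ t : ZMod p, t ≠ 0 ∧ t • u ∈ V₁
  have hScard : S.card * K ≤ 2 * A.card := by
    refine card_centres_mul_le h2 A S K fun c hc => ?_
    have hc' := (Finset.mem_filter.mp hc).2
    rw [hC₁] at hc'
    refine lt_of_lt_of_le hc' (Nat.cast_le.mpr (Set.ncard_le_ncard ?_
      (A.finite_toSet.subset fun a ha => ha.1)))
    rw [hAc, hΓ]
    rintro a ⟨ha, γ, hγ, hγc, haγ⟩
    exact ⟨ha, γ, ⟨hγc, hγ.2⟩, haγ⟩
  have hDcard : D.card * K ≤ 2 * A.card := by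
    refine card_directions_mul_le A D K fun u hu => ?_
    obtain ⟨hn, t, ht, hv⟩ := (Finset.mem_filter.mp hu).2
    refine ⟨hn, t, ht, ?_⟩
    rw [hV₁] at hv
    refine lt_of_lt_of_le hv.2 (Nat.cast_le.mpr (Set.ncard_le_ncard ?_
      (A.finite_toSet.subset fun a ha => ha.1)))
    rw [hAv, hΓ]
    rintro a ⟨ha, γ, hγ, -, hγv, haγ⟩
    exact ⟨ha, γ, ⟨hγv, hγ.2⟩, haγ⟩
  have hcount := card_isosceles_le A S D (fun t => bisector t.2.1 t.2.2 ∈ L₁) (by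
    intro t hI ht
    rw [hL₁] at ht
    obtain ⟨-, ⟨c, hc, hcl⟩ | ⟨v, hv, w, hw, hwv⟩⟩ := ht
    · exact Or.inl ⟨c, Finset.mem_filter.mpr ⟨Finset.mem_univ _, hc⟩, hcl⟩
    · have hv0 : v ≠ 0 := by rw [hV₁] at hv; exact hv.1
      obtain ⟨u, hu, r, hr, rfl⟩ := exists_isNormalized_smul hv0
      obtain ⟨s, hs⟩ := exists_smul_of_hasDir_bisector hv0 hI.2.2 hw hwv
      exact Or.inr ⟨u, Finset.mem_filter.mpr ⟨Finset.mem_univ _, hu, r, hr, hv⟩, s * r,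
        by rw [hs, smul_smul]⟩)
  rw [← Nat.cast_le (α := ℝ)] at hcount
  push_cast at hcount
  refine hcount.trans (le_of_mul_le_mul_right ?_ hK0)
  have hKA : (p : ℝ) ^ ((2 : ℝ) / 3) * (A.card : ℝ) ^ ((5 : ℝ) / 3) * K = A.card ^ 3 := by
    have h1 : (p : ℝ) ^ ((2 : ℝ) / 3) * (p : ℝ) ^ (-((2 : ℝ) / 3)) = 1 := by
      rw [← Real.rpow_add hp0, add_neg_cancel, Real.rpow_zero]
    have h2 : (A.card : ℝ) ^ ((5 : ℝ) / 3) * (A.card : ℝ) ^ ((4 : ℝ) / 3) = A.card ^ 3 := by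
      rw [← Real.rpow_add hA0, ← Real.rpow_natCast]; norm_num
    rw [hKdef]
    linear_combination (A.card : ℝ) ^ ((5 : ℝ) / 3) * (A.card : ℝ) ^ ((4 : ℝ) / 3) * h1 + h2
  calc ((S.card : ℝ) * (2 * A.card ^ 2) + D.card * A.card ^ 2) * K
      = 2 * A.card ^ 2 * (S.card * K) + A.card ^ 2 * (D.card * K) := by ring
    _ ≤ 2 * (A.card : ℝ) ^ 2 * (2 * A.card) + (A.card : ℝ) ^ 2 * (2 * A.card) :=
        add_le_add (mul_le_mul_of_nonneg_left hScard (mul_nonneg zero_le_two (sq_nonneg _)))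
          (mul_le_mul_of_nonneg_left hDcard (sq_nonneg _))
    _ = 6 * (A.card : ℝ) ^ 3 := by ring
    _ = 6 * (p : ℝ) ^ ((2 : ℝ) / 3) * (A.card : ℝ) ^ ((5 : ℝ) / 3) * K := by
        rw [← hKA]; ring

end Stmt15
end

section
/- Let F be a field of characteristic different from 2 and let λ ∈ F with λ ≠ 0. Let V = F³ with the quadratic form Q(x,y,z) := x² − λy², let Cl(V,Q) be the associated Clifford algebra, let Cl⁺(V,Q) be its even subalgebra, let G be the group of units of Cl⁺(V,Q), and let Z be the centre of G. Let SF(Q₀) be the group of 3×3 matrices over F of the form [[u, v, s], [λv, u, t], [0, 0, 1]] with u² − λv² = 1 (u, v, s, t ∈ F), under matrix multiplication. Then the quotient group G/Z is isomorphic to SF(Q₀). -/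
namespace Stmt17

/-- The quadratic form `Q(x,y,z) = x² - λy²` on `F³`. -/
noncomputable def Q (F : Type) [Field F] (lam : F) : QuadraticForm F (Fin 3 → F) :=
  QuadraticMap.weightedSumSquares F ![1, -lam, 0]

/-- The set of matrices representing the group `SF(Q₀)` of rigid motions:
`[[u, v, s], [λv, u, t], [0, 0, 1]]` with `u² - λv² = 1`. -/
def SFSet (F : Type) [Field F] (lam : F) : Set (Matrix (Fin 3) (Fin 3) F) :=
  {m | ∃ u v s t : F, u ^ 2 - lam * v ^ 2 = 1 ∧
    m = !![u, v, s; lam * v, u, t; 0, 0, 1]}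

open scoped Quaternion

section EvenIsometry

variable {R M₁ M₂ : Type*} [CommRing R] [AddCommGroup M₁] [Module R M₁] [AddCommGroup M₂]
  [Module R M₂] {Q₁ : QuadraticForm R M₁} {Q₂ : QuadraticForm R M₂}

/-- An isometry induces a morphism between the even Clifford subalgebras. -/
noncomputable def evenMap (f : Q₁ →qᵢ Q₂) :
    CliffordAlgebra.even Q₁ →ₐ[R] CliffordAlgebra.even Q₂ :=
  CliffordAlgebra.even.lift Q₁
    { bilin := (CliffordAlgebra.even.ι Q₂).bilin.compl₁₂ f.toLinearMap f.toLinearMap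
      contract := fun m => by
        simpa using (CliffordAlgebra.even.ι Q₂).contract (f m)
      contract_mid := fun m₁ m₂ m₃ => by
        simpa using (CliffordAlgebra.even.ι Q₂).contract_mid (f m₁) (f m₂) (f m₃) }

theorem evenMap_ι (f : Q₁ →qᵢ Q₂) (m₁ m₂ : M₁) :
    evenMap f ((CliffordAlgebra.even.ι Q₁).bilin m₁ m₂) =
      (CliffordAlgebra.even.ι Q₂).bilin (f m₁) (f m₂) :=
  CliffordAlgebra.even.lift_ι _ _ m₁ m₂

/-- Isometric quadratic forms have isomorphic even Clifford subalgebras. -/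
noncomputable def evenEquivOfIsometry (e : Q₁.IsometryEquiv Q₂) :
    CliffordAlgebra.even Q₁ ≃ₐ[R] CliffordAlgebra.even Q₂ :=
  AlgEquiv.ofAlgHom (evenMap e.toIsometry) (evenMap e.symm.toIsometry)
    (by ext m₁ m₂ : 4; simp [evenMap_ι])
    (by ext m₁ m₂ : 4; simp [evenMap_ι])

end EvenIsometry

section Quaternion

variable {F : Type} [Field F] {lam : F}

/-- The isometry between `-Q` and the form whose even Clifford subalgebra is the quaternion
algebra `ℍ[F, lam, 0]`. -/
def negQIsometry (F : Type) [Field F] (lam : F) : (-(Q F lam)).IsometryEquiv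
    (CliffordAlgebra.EquivEven.Q' (CliffordAlgebraQuaternion.Q lam 0)) where
  toFun v := ((v 1, v 2), v 0)
  invFun p := ![p.2, p.1.1, p.1.2]
  map_add' _ _ := rfl
  map_smul' _ _ := rfl
  left_inv v := by ext i; fin_cases i <;> rfl
  right_inv _ := rfl
  map_app' v := by
    simp [Q, QuadraticMap.weightedSumSquares_apply, Fin.sum_univ_three]

/-- The even Clifford subalgebra of `Q` is a degenerate quaternion algebra. -/
noncomputable def evenEquivQuaternion (F : Type) [Field F] (lam : F) :
    CliffordAlgebra.even (Q F lam) ≃ₐ[F] ℍ[F, lam, 0] :=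
  (CliffordAlgebra.evenEquivEvenNeg (Q F lam)).trans <|
    (evenEquivOfIsometry (negQIsometry F lam)).trans <|
      (CliffordAlgebra.equivEven (CliffordAlgebraQuaternion.Q lam 0)).symm.trans
        CliffordAlgebraQuaternion.equiv

/-- The norm of the degenerate quaternion algebra `ℍ[F, lam, 0]`. -/
def quatNorm (q : ℍ[F, lam, 0]) : F := q.re ^ 2 - lam * q.imI ^ 2

theorem quatNorm_mul (p q : ℍ[F, lam, 0]) : quatNorm (p * q) = quatNorm p * quatNorm q := by
  simp [quatNorm]
  ring

theorem quatNorm_unit_ne_zero (q : (ℍ[F, lam, 0])ˣ) : quatNorm (q : ℍ[F, lam, 0]) ≠ 0 := by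
  intro h
  have := quatNorm_mul (q : ℍ[F, lam, 0]) ↑q⁻¹
  simp [h] at this
  simp [quatNorm] at this

theorem isUnit_of_quatNorm_ne_zero {q : ℍ[F, lam, 0]} (h : quatNorm q ≠ 0) : IsUnit q := by
  have h' : star q * q = quatNorm q • 1 := by
    ext <;> simp [quatNorm] <;> ring
  have h'' : q * star q = quatNorm q • 1 := by
    ext <;> simp [quatNorm] <;> ring
  refine ⟨⟨q, (quatNorm q)⁻¹ • star q, ?_, ?_⟩, rfl⟩
  · rw [mul_smul_comm, h'', smul_smul, inv_mul_cancel₀ h, one_smul]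
  · rw [smul_mul_assoc, h', smul_smul, inv_mul_cancel₀ h, one_smul]

/-- For `q = z + w j` with `z, w ∈ F[i]`, the rigid motion `p ↦ (z / z̄) p + w / z̄`. -/
noncomputable def rigidMotion (F : Type) [Field F] (lam : F) :
    (ℍ[F, lam, 0])ˣ →* Matrix (Fin 3) (Fin 3) F where
  toFun x :=
    let q : ℍ[F, lam, 0] := x
    let u := (q.re ^ 2 + lam * q.imI ^ 2) / quatNorm q
    let v := 2 * q.re * q.imI / quatNorm q
    !![u, v, (q.re * q.imK + q.imI * q.imJ) / quatNorm q;
      lam * v, u, (q.re * q.imJ + lam * q.imI * q.imK) / quatNorm q; 0, 0, 1]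
  map_one' := by
    ext i j
    fin_cases i <;> fin_cases j <;> simp [quatNorm]
  map_mul' x y := by
    have hx := quatNorm_unit_ne_zero x
    have hy := quatNorm_unit_ne_zero y
    ext i j
    fin_cases i <;> fin_cases j <;>
      simp [quatNorm_mul, Matrix.mul_apply, Fin.sum_univ_three] <;> field_simp <;>
      (try simp only [quatNorm]) <;> ring

theorem rigidMotion_eq_one_iff (h2 : (2 : F) ≠ 0) (hlam : lam ≠ 0) (x : (ℍ[F, lam, 0])ˣ) :
    rigidMotion F lam x = 1 ↔ (x : ℍ[F, lam, 0]).imI = 0 ∧ (x : ℍ[F, lam, 0]).imJ = 0 ∧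
      (x : ℍ[F, lam, 0]).imK = 0 := by
  have hx := quatNorm_unit_ne_zero x
  constructor
  · intro h
    have h00 := congrFun (congrFun h 0) 0
    have h02 := congrFun (congrFun h 0) 2
    have h12 := congrFun (congrFun h 1) 2
    simp [rigidMotion, hx, div_eq_iff] at h00 h02 h12
    have hI : (x : ℍ[F, lam, 0]).imI = 0 := by
      have : 2 * lam * (x : ℍ[F, lam, 0]).imI ^ 2 = 0 := by
        simp only [quatNorm] at h00
        linear_combination h00
      simpa [h2, hlam] using this
    have hre : (x : ℍ[F, lam, 0]).re ≠ 0 := by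
      intro h0
      simp [quatNorm, hI, h0] at hx
    simp [hI, hre] at h02 h12
    exact ⟨hI, h12, h02⟩
  · rintro ⟨hI, hJ, hK⟩
    simp only [quatNorm, hI] at hx
    have hre : (x : ℍ[F, lam, 0]).re ≠ 0 := by
      intro h0
      simp [h0] at hx
    ext i j
    fin_cases i <;> fin_cases j <;> simp [rigidMotion, quatNorm, hI, hJ, hK, hre]

theorem mem_center_quaternion_units_iff (h2 : (2 : F) ≠ 0) (hlam : lam ≠ 0)
    (x : (ℍ[F, lam, 0])ˣ) :
    x ∈ Subgroup.center (ℍ[F, lam, 0])ˣ ↔ (x : ℍ[F, lam, 0]).imI = 0 ∧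
      (x : ℍ[F, lam, 0]).imJ = 0 ∧ (x : ℍ[F, lam, 0]).imK = 0 := by
  rw [Subgroup.mem_center_iff]
  constructor
  · intro h
    obtain ⟨i, hi⟩ := isUnit_of_quatNorm_ne_zero (q := (⟨0, 1, 0, 0⟩ : ℍ[F, lam, 0]))
      (by simpa [quatNorm] using hlam)
    obtain ⟨j, hj⟩ := isUnit_of_quatNorm_ne_zero (q := (⟨1, 0, 1, 0⟩ : ℍ[F, lam, 0]))
      (by simp [quatNorm])
    have hxi := congrArg Units.val (h i)
    have hxj := congrArg Units.val (h j)
    rw [Units.val_mul, Units.val_mul, hi, QuaternionAlgebra.ext_iff] at hxi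
    rw [Units.val_mul, Units.val_mul, hj, QuaternionAlgebra.ext_iff] at hxj
    simp at hxi hxj
    have eq_zero : ∀ {a : F}, 2 * a = 0 → a = 0 := fun h => by simpa [h2] using h
    refine ⟨eq_zero ?_, eq_zero ?_, eq_zero (mul_left_cancel₀ hlam ?_)⟩
    · linear_combination -hxj.2
    · linear_combination hxi.2
    · linear_combination hxi.1
  · rintro ⟨hI, hJ, hK⟩ g
    ext <;> simp [hI, hJ, hK, mul_comm]

theorem range_rigidMotion (h2 : (2 : F) ≠ 0) (hlam : lam ≠ 0) :
    Set.range (rigidMotion F lam) = SFSet F lam := by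
  ext m
  constructor
  · rintro ⟨x, rfl⟩
    have hx := quatNorm_unit_ne_zero x
    refine ⟨_, _, _, _, ?_, rfl⟩
    field_simp
    simp only [quatNorm]
    ring
  · rintro ⟨u, v, s, t, huv, rfl⟩
    obtain ⟨a, b, hN, hu, hv⟩ : ∃ a b : F, a ^ 2 - lam * b ^ 2 ≠ 0 ∧
        a ^ 2 + lam * b ^ 2 = u * (a ^ 2 - lam * b ^ 2) ∧
        2 * a * b = v * (a ^ 2 - lam * b ^ 2) := by
      by_cases hu : 1 + u = 0
      · obtain rfl : u = -1 := by linear_combination hu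
        obtain rfl : v = 0 := by simpa [hlam] using huv
        exact ⟨0, 1, by simpa using hlam, by ring, by ring⟩
      · have hN : (1 + u) ^ 2 - lam * v ^ 2 = 2 * (1 + u) := by linear_combination huv
        refine ⟨1 + u, v, by rw [hN]; exact mul_ne_zero h2 hu, ?_, ?_⟩ <;> rw [hN]
        · linear_combination -huv
        · ring
    obtain ⟨x, hx⟩ := isUnit_of_quatNorm_ne_zero
      (q := (⟨a, b, t * a - lam * s * b, s * a - t * b⟩ : ℍ[F, lam, 0])) hN
    refine ⟨x, ?_⟩
    have hu' := (div_eq_iff hN).2 hu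
    have hv' := (div_eq_iff hN).2 hv
    have hs : (a * (s * a - t * b) + b * (t * a - lam * s * b)) / (a ^ 2 - lam * b ^ 2) = s := by
      rw [div_eq_iff hN]; ring
    have ht : (a * (t * a - lam * s * b) + lam * b * (s * a - t * b)) /
        (a ^ 2 - lam * b ^ 2) = t := by
      rw [div_eq_iff hN]; ring
    simp only [rigidMotion, quatNorm, MonoidHom.coe_mk, OneHom.coe_mk, hx, hu', hv', hs, ht]

end Quaternion

theorem exists_injective_quotient_center {G M : Type*} [Group G] [Monoid M] (f : G →* M)
    (hf : ∀ x, f x = 1 ↔ x ∈ Subgroup.center G) :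
    ∃ φ : G ⧸ Subgroup.center G → M, Function.Injective φ ∧
      (∀ x y, φ (x * y) = φ x * φ y) ∧ Set.range φ = Set.range f := by
  refine ⟨QuotientGroup.lift (Subgroup.center G) f fun x hx => f.mem_ker.2 ((hf x).2 hx), ?_, map_mul _, ?_⟩
  · intro x y
    induction x using QuotientGroup.induction_on with | _ x
    induction y using QuotientGroup.induction_on with | _ y
    intro h
    rw [QuotientGroup.lift_mk, QuotientGroup.lift_mk] at h
    rw [QuotientGroup.eq, ← hf, map_mul, ← h, ← map_mul, inv_mul_cancel, map_one]
  · ext m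
    constructor
    · rintro ⟨x, rfl⟩
      induction x using QuotientGroup.induction_on with | _ x
      exact ⟨x, rfl⟩
    · rintro ⟨x, rfl⟩
      exact ⟨x, rfl⟩

/-- Let `F` be a field of characteristic `≠ 2`, `λ ≠ 0`, `Q(x,y,z) = x² - λy²` on `V = F³`,
`G` the group of units of the even Clifford subalgebra `Cl⁺(V,Q)`, and `Z` its centre. Then
`G/Z` is isomorphic to `SF(Q₀)`: there is an injective multiplication-preserving map from
`G/Z` to the `3×3` matrices over `F` whose range is exactly `SF(Q₀)`. -/
theorem even_clifford_units_mod_center_iso_SF (F : Type) [Field F]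
    (h2 : (2 : F) ≠ 0) (lam : F) (hlam : lam ≠ 0) :
    ∃ φ : ((CliffordAlgebra.even (Q F lam))ˣ ⧸
            Subgroup.center ((CliffordAlgebra.even (Q F lam))ˣ)) →
          Matrix (Fin 3) (Fin 3) F,
      Function.Injective φ ∧
      (∀ x y, φ (x * y) = φ x * φ y) ∧
      Set.range φ = SFSet F lam := by
  let e : (CliffordAlgebra.even (Q F lam))ˣ ≃* (ℍ[F, lam, 0])ˣ :=
    Units.mapEquiv (evenEquivQuaternion F lam).toMulEquiv
  have hker : ∀ x, (rigidMotion F lam).comp e.toMonoidHom x = 1 ↔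
      x ∈ Subgroup.center (CliffordAlgebra.even (Q F lam))ˣ := by
    intro x
    rw [MonoidHom.comp_apply, rigidMotion_eq_one_iff h2 hlam,
      ← mem_center_quaternion_units_iff h2 hlam, Subgroup.mem_center_iff, Subgroup.mem_center_iff,
      ← e.forall_congr_right]
    refine forall_congr' fun g => ?_
    change e g * e x = e x * e g ↔ _
    rw [← map_mul, ← map_mul, e.injective.eq_iff]
  obtain ⟨φ, hinj, hmul, hrange⟩ := exists_injective_quotient_center _ hker
  refine ⟨φ, hinj, hmul, hrange.trans ?_⟩
  rw [← range_rigidMotion h2 hlam]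
  exact e.surjective.range_comp (rigidMotion F lam)

end Stmt17
end
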